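/- Let T be a triangulated category with arbitrary small coproducts and let P be a compact generator of T. Then for every projective graded right Λ-module M there exists an object G of T such that π_*G ≅ M as graded right Λ-modules. -/

import Mathlib

/-!
Shared setup: a triangulated category `C` with (co)products, a compact generator `P`,
the graded endomorphism ring `Λ = End_T(P)_* = Hom_T(Σ^* P, P)` and its category of
graded right modules, realized concretely.
-/

set_option linter.unusedSectionVars false

open CategoryTheory CategoryTheory.Limits CategoryTheory.Pretriangulated DirectSum

universe v u

namespace Franke

variable {C : Type u} [Category.{v} C] [Preadditive C] [HasZeroObject C]
  [HasShift C ℤ] [∀ n : ℤ, (shiftFunctor C n).Additive] [Pretriangulated C]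

/-- The degree `k` component of the graded endomorphism ring
`Λ = End_T(P)_* = Hom_T(Σ^* P, P)`: its degree `k` part is `Hom(P⟦k⟧, P)`. -/
abbrev lam (P : C) (k : ℤ) : Type v := (P⟦k⟧ ⟶ P)

/-- The right action of a degree `k` element `a : Σᵏ P ⟶ P` of `Λ` on a degree `n`
element `m : Σⁿ P ⟶ X` of the graded hom `π_* X = Hom_T(Σ^* P, X)`; the result is the
degree `n + k` element `Σ^{n+k} P ≅ (Σᵏ P)⟦n⟧ → Σⁿ P → X`. -/
def gsmulHom (P : C) {X : C} {n k l : ℤ} (h : n + k = l)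
    (m : P⟦n⟧ ⟶ X) (a : lam P k) : P⟦l⟧ ⟶ X :=
  (shiftFunctorAdd' C k n l (by omega)).hom.app P ≫ a⟦n⟧' ≫ m

/-- The multiplication of the graded endomorphism ring `Λ = End_T(P)_*`. -/
def gmul (P : C) {j k l : ℤ} (h : j + k = l) (a : lam P j) (b : lam P k) : lam P l :=
  gsmulHom P h a b

/-- The unit `1 ∈ Λ₀ = Hom(Σ⁰P, P)` of the graded endomorphism ring. -/
def gone (P : C) : lam P 0 := (shiftFunctorZero C ℤ).hom.app P

/-- A ℤ-graded right module over the graded endomorphism ring `Λ = End_T(P)_*`.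
The action is indexed by proofs `n + k = l` in order to avoid transport along
equalities of degrees. -/
structure GradedModule (P : C) where
  M : ℤ → Type v
  [acg : ∀ n, AddCommGroup (M n)]
  smul : ∀ {n k l : ℤ}, n + k = l → M n → lam P k → M l
  smul_addₓ : ∀ {n k l : ℤ} (h : n + k = l) (m : M n) (a b : lam P k),
    smul h m (a + b) = smul h m a + smul h m b
  add_smulₓ : ∀ {n k l : ℤ} (h : n + k = l) (m m' : M n) (a : lam P k),
    smul h (m + m') a = smul h m a + smul h m' a
  smul_oneₓ : ∀ {n : ℤ} (m : M n), smul (add_zero n) m (gone P) = m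
  smul_mulₓ : ∀ {n j k nj jk njk : ℤ} (h₁ : n + j = nj) (h₂ : j + k = jk)
    (h₃ : nj + k = njk) (h₄ : n + jk = njk) (m : M n) (a : lam P j) (b : lam P k),
    smul h₃ (smul h₁ m a) b = smul h₄ m (gmul P h₂ a b)

attribute [instance] GradedModule.acg

/-- The action of a fixed `a : Λₖ` as an additive map `Mₙ →+ M_{n+k}`. -/
def GradedModule.smulAddHom {P : C} (M : GradedModule P) {n k l : ℤ} (h : n + k = l)
    (a : lam P k) : M.M n →+ M.M l :=
  AddMonoidHom.mk' (fun m => M.smul h m a) (fun m m' => M.add_smulₓ h m m' a)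

theorem GradedModule.zero_smulₓ {P : C} (M : GradedModule P) {n k l : ℤ} (h : n + k = l)
    (a : lam P k) : M.smul h (0 : M.M n) a = 0 :=
  map_zero (M.smulAddHom h a)

/-- `π_* X = Hom_T(Σ^* P, X)` as a graded right `Λ`-module. -/
@[reducible] def piMod (P X : C) : GradedModule P where
  M n := P⟦n⟧ ⟶ X
  smul h m a := gsmulHom P h m a
  smul_addₓ h m a b := by
    simp [gsmulHom, Functor.map_add, Preadditive.comp_add, Preadditive.add_comp]
  add_smulₓ h m m' a := by
    simp [gsmulHom, Preadditive.comp_add]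
  smul_oneₓ m := by
    simp only [gsmulHom, gone]
    rw [shiftFunctorAdd'_zero_add_hom_app, ← Functor.map_comp_assoc, Iso.inv_hom_id_app]
    simp
  smul_mulₓ {n j k nj jk njk} h₁ h₂ h₃ h₄ m a b := by
    simp only [gsmulHom, gmul, Functor.map_comp, Category.assoc]
    have nat := ((shiftFunctorAdd' C j n nj (by omega)).hom).naturality b
    dsimp at nat
    rw [reassoc_of% nat]
    rw [← shiftFunctorAdd'_assoc_hom_app_assoc k j n jk nj njk (by omega) (by omega)
      (by omega) P]


/-- A morphism of graded right `Λ`-modules: a degree-preserving `Λ`-linear additive map. -/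
structure GHom {P : C} (M N : GradedModule P) where
  app : ∀ n : ℤ, M.M n →+ N.M n
  app_smul : ∀ {n k l : ℤ} (h : n + k = l) (m : M.M n) (a : lam P k),
    app l (M.smul h m a) = N.smul h (app n m) a

@[ext] theorem GHom.ext {P : C} {M N : GradedModule P} {f g : GHom M N}
    (h : ∀ (n : ℤ) (x : M.M n), f.app n x = g.app n x) : f = g := by
  obtain ⟨fa, _⟩ := f; obtain ⟨ga, _⟩ := g
  congr 1
  funext n
  exact AddMonoidHom.ext (h n)

/-- The identity morphism of graded modules. -/
def GHom.id {P : C} (M : GradedModule P) : GHom M M :=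
  ⟨fun _ => AddMonoidHom.id _, fun _ _ _ => rfl⟩

/-- Composition of morphisms of graded modules. -/
def GHom.comp {P : C} {M N K : GradedModule P} (g : GHom N K) (f : GHom M N) : GHom M K :=
  ⟨fun n => (g.app n).comp (f.app n), fun h m a => by
    simp only [AddMonoidHom.comp_apply, f.app_smul, g.app_smul]⟩

instance {P : C} {M N : GradedModule P} : Zero (GHom M N) :=
  ⟨{ app := fun _ => 0
     app_smul := fun h m a => by
       show (0 : N.M _) = N.smul h (0 : N.M _) a
       exact (N.zero_smulₓ h a).symm }⟩

@[simp] theorem GHom.zero_app {P : C} {M N : GradedModule P} (n : ℤ) (x : M.M n) :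
    (0 : GHom M N).app n x = 0 := rfl

/-- An isomorphism of graded right `Λ`-modules. -/
structure GIso {P : C} (M N : GradedModule P) where
  hom : GHom M N
  inv : GHom N M
  hom_inv_id : inv.comp hom = GHom.id M
  inv_hom_id : hom.comp inv = GHom.id N

/-- The shift `M[k]` of a graded module, with `M[k]ₙ = M_{n-k}`. -/
@[reducible] def gshift {P : C} (k : ℤ) (M : GradedModule P) : GradedModule P where
  M n := M.M (n - k)
  smul h m a := M.smul (by omega) m a
  smul_addₓ h m a b := M.smul_addₓ _ m a b
  add_smulₓ h m m' a := M.add_smulₓ _ m m' a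
  smul_oneₓ m := M.smul_oneₓ m
  smul_mulₓ h₁ h₂ h₃ h₄ m a b := M.smul_mulₓ _ h₂ _ _ m a b

/-- Surjectivity (in each degree) of a morphism of graded modules. -/
def GHom.Surj {P : C} {M N : GradedModule P} (f : GHom M N) : Prop :=
  ∀ n : ℤ, Function.Surjective (f.app n)

/-- A pair of composable morphisms of graded modules `0 → Z → E → B → 0`
forming a short exact sequence. -/
structure IsShortExact {P : C} {Z E B : GradedModule P} (ι : GHom Z E) (ρ : GHom E B) : Prop where
  mono : ∀ n : ℤ, Function.Injective (ι.app n)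
  epi : ∀ n : ℤ, Function.Surjective (ρ.app n)
  exact : ∀ (n : ℤ) (x : E.M n), ρ.app n x = 0 ↔ x ∈ Set.range (ι.app n)

/-- Exactness of `M → N → K` at `N` (including that the composite vanishes). -/
def ExactPair {P : C} {M N K : GradedModule P} (f : GHom M N) (g : GHom N K) : Prop :=
  ∀ (n : ℤ) (x : N.M n), g.app n x = 0 ↔ x ∈ Set.range (f.app n)

/-- A graded module is projective if every degreewise surjection onto it splits against
any map from it: the usual lifting property. -/
def IsProjective {P : C} (Q : GradedModule P) : Prop :=
  ∀ (A B : GradedModule P) (e : GHom A B), e.Surj →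
    ∀ f : GHom Q B, ∃ g : GHom Q A, e.comp g = f

/-- `projDimLE d M` says that the graded module `M` admits a projective resolution of
length at most `d`, i.e. has projective dimension `≤ d`. -/
def projDimLE {P : C} : ℕ → GradedModule P → Prop
  | 0, M => IsProjective M
  | d + 1, M => ∃ (F K : GradedModule P) (ε : GHom F M) (ι : GHom K F),
      IsProjective F ∧ IsShortExact ι ε ∧ projDimLE d K

/-- `Λ = End_T(P)_*` is `N`-sparse: concentrated in degrees divisible by `N`. -/
def Sparse (P : C) (N : ℕ) : Prop :=
  ∀ k : ℤ, ¬ ((N : ℤ) ∣ k) → ∀ a : lam P k, a = 0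

/-- A graded module belongs to `B[i]`: it is concentrated in degrees congruent
to `i` modulo `N`. -/
def InDegrees {P : C} (N : ℕ) (i : ZMod N) (M : GradedModule P) : Prop :=
  ∀ n : ℤ, (n : ZMod N) ≠ i → ∀ x : M.M n, x = 0

/-- The canonical comparison map `⊕ᵢ Hom(P, Xᵢ) → Hom(P, ∐ᵢ Xᵢ)`. -/
noncomputable def compactComparison [HasCoproducts.{v} C] (P : C) {ι : Type v} (X : ι → C) :
    (⨁ i, (P ⟶ X i)) →+ (P ⟶ ∐ X) := by
  classical
  exact DirectSum.toAddMonoid fun i =>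
    AddMonoidHom.mk' (fun f => f ≫ Sigma.ι X i) (fun f g => Preadditive.add_comp _ _ _ _ _ _)

/-- `P` is a compact object: `Hom(P, −)` commutes with small coproducts. -/
def IsCompactObj [HasCoproducts.{v} C] (P : C) : Prop :=
  ∀ (ι : Type v) (X : ι → C), Function.Bijective (compactComparison P X)

/-- `P` is a generator: an object all of whose graded homs from `P` vanish is zero. -/
def IsGenerator (P : C) : Prop :=
  ∀ X : C, (∀ (n : ℤ) (f : P⟦n⟧ ⟶ X), f = 0) → IsZero X

/-- The morphism of graded modules `π_* f : π_* X → π_* Y` induced by `f : X ⟶ Y`. -/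
def piGHom (P : C) {X Y : C} (f : X ⟶ Y) : GHom (piMod P X) (piMod P Y) where
  app n := AddMonoidHom.mk' (fun u => u ≫ f) fun u v => Preadditive.add_comp _ _ _ _ _ _
  app_smul h m a := by
    show (gsmulHom P h m a) ≫ f = gsmulHom P h (m ≫ f) a
    simp [gsmulHom]

/-- An extension of `B` by `Z` in the category of graded right `Λ`-modules:
  a short exact sequence `0 → Z → E → B → 0`. -/
structure GExtension {P : C} (B Z : GradedModule P) where
  E : GradedModule P
  ι : GHom Z E
  ρ : GHom E B
  shortExact : IsShortExact ι ρ

/-- Two extensions are identified if there is a morphism of extensions between them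
(such a morphism is automatically an isomorphism). -/
def GExtension.Rel {P : C} {B Z : GradedModule P} (e e' : GExtension B Z) : Prop :=
  ∃ φ : GHom e.E e'.E, φ.comp e.ι = e'.ι ∧ e'.ρ.comp φ = e.ρ

/-- `Ext¹_Λ(B, Z)`, realized as the set of equivalence classes of extensions
`0 → Z → E → B → 0` of graded right `Λ`-modules. -/
def Ext1 {P : C} (B Z : GradedModule P) : Type _ :=
  Quot (GExtension.Rel (B := B) (Z := Z))

/-- Given `δ : Cc ⟶ ΣX`, the induced morphism of graded modules
`π_* Cc → (π_* X)[1]`, using the canonical identification `π_*(ΣX) ≅ (π_*X)[1]`. -/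
noncomputable def triangleConnect (P : C) {X Cc : C} (δ : Cc ⟶ X⟦(1:ℤ)⟧) :
    GHom (piMod P Cc) (gshift 1 (piMod P X)) where
  app n := AddMonoidHom.mk' (fun u =>
    (shiftFunctorAdd' C n (-1) (n-1) (by omega)).hom.app P ≫ (u ≫ δ)⟦(-1:ℤ)⟧' ≫
      (shiftFunctorCompIsoId C (1:ℤ) (-1) (by omega)).hom.app X) (fun u v => by
        simp [Preadditive.add_comp, Preadditive.comp_add, Functor.map_add])
  app_smul {n k l} h m a := by
    simp only [AddMonoidHom.mk'_apply]
    show (shiftFunctorAdd' C l (-1) (l-1) (by omega)).hom.app P ≫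
        ((gsmulHom P h m a) ≫ δ)⟦(-1:ℤ)⟧' ≫
          (shiftFunctorCompIsoId C (1:ℤ) (-1) (by omega)).hom.app X =
      gsmulHom P (show (n-1) + k = l - 1 by omega)
        ((shiftFunctorAdd' C n (-1) (n-1) (by omega)).hom.app P ≫ (m ≫ δ)⟦(-1:ℤ)⟧' ≫
          (shiftFunctorCompIsoId C (1:ℤ) (-1) (by omega)).hom.app X) a
    simp only [gsmulHom, Functor.map_comp, Category.assoc]
    have nat := ((shiftFunctorAdd' C n (-1) (n-1) (by omega : n + -1 = n - 1)).hom).naturality a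
    dsimp at nat
    rw [reassoc_of% nat]
    rw [shiftFunctorAdd'_assoc_hom_app_assoc k n (-1) l (n-1) (l-1) (by omega) (by omega)
      (by omega) P]

section ExtGroups

instance {P : C} {M N : GradedModule P} : Add (GHom M N) :=
  ⟨fun f g =>
    { app := fun n => f.app n + g.app n
      app_smul := fun {n k l} h m a => by
        show f.app l _ + g.app l _ = N.smul h (f.app n m + g.app n m) a
        rw [f.app_smul, g.app_smul, N.add_smulₓ] }⟩

instance {P : C} {M N : GradedModule P} : Neg (GHom M N) :=
  ⟨fun f =>
    { app := fun n => -(f.app n)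
      app_smul := fun {n k l} h m a => by
        show -(f.app l _) = N.smul h (-(f.app n m)) a
        rw [f.app_smul]
        exact (map_neg (N.smulAddHom h a) _).symm }⟩

@[simp] theorem GHom.add_app {P : C} {M N : GradedModule P} (f g : GHom M N) (n : ℤ)
    (x : M.M n) : (f + g).app n x = f.app n x + g.app n x := rfl

@[simp] theorem GHom.neg_app {P : C} {M N : GradedModule P} (f : GHom M N) (n : ℤ)
    (x : M.M n) : (-f).app n x = -(f.app n x) := rfl

instance {P : C} {M N : GradedModule P} : AddCommGroup (GHom M N) where
  add := (· + ·)
  zero := 0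
  neg := Neg.neg
  add_assoc f g h := by ext n x; simp [add_assoc]
  zero_add f := by ext n x; simp
  add_zero f := by ext n x; simp
  add_comm f g := by ext n x; simp [add_comm]
  neg_add_cancel f := by ext n x; simp
  nsmul := nsmulRec
  zsmul := zsmulRec

/-- A projective resolution `⋯ → F₂ → F₁ → F₀ → B → 0` of a graded right `Λ`-module. -/
structure ProjResolution {P : C} (B : GradedModule P) where
  F : ℕ → GradedModule P
  d : ∀ i : ℕ, GHom (F (i + 1)) (F i)
  aug : GHom (F 0) B
  projective : ∀ i, IsProjective (F i)
  aug_surjective : ∀ n : ℤ, Function.Surjective (aug.app n)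
  exact_aug : ∀ (n : ℤ) (x : (F 0).M n), aug.app n x = 0 ↔ x ∈ Set.range ((d 0).app n)
  exact_d : ∀ (i : ℕ) (n : ℤ) (x : (F (i + 1)).M n),
    (d i).app n x = 0 ↔ x ∈ Set.range ((d (i + 1)).app n)

/-- The differential of the cochain complex `Hom_Λ(F_•, Z)` obtained by applying
`Hom_Λ(−, Z)` to a projective resolution `F_•`. -/
def cochainD {P : C} {B : GradedModule P} (R : ProjResolution B) (Z : GradedModule P)
    (i : ℕ) : GHom (R.F i) Z →+ GHom (R.F (i + 1)) Z :=
  AddMonoidHom.mk' (fun f => f.comp (R.d i)) (fun f g => by ext n x; rfl)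

/-- `Ext^{j+1}_Λ(B, Z)`, computed as the `(j+1)`-st cohomology
`ker(Hom(F_{j+1}, Z) → Hom(F_{j+2}, Z)) / im(Hom(F_j, Z) → Hom(F_{j+1}, Z))`
of the complex `Hom_Λ(F_•, Z)` for a projective resolution `F_• → B`. -/
def extGroup {P : C} {B : GradedModule P} (R : ProjResolution B) (Z : GradedModule P)
    (j : ℕ) : Type v :=
  AddMonoidHom.ker (cochainD R Z (j + 1)) ⧸
    (AddMonoidHom.range (cochainD R Z j)).addSubgroupOf
      (AddMonoidHom.ker (cochainD R Z (j + 1)))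

noncomputable instance {P : C} {B : GradedModule P} (R : ProjResolution B)
    (Z : GradedModule P) (j : ℕ) : AddCommGroup (extGroup R Z j) := by
  dsimp [extGroup]; infer_instance

end ExtGroups
section DG

/-- A differential graded right module over `Λ = End_T(P)_*`, where `Λ` is regarded as a
DG ring with zero differential: a graded right `Λ`-module together with a square-zero
`Λ`-linear differential of degree `-1`. -/
structure DGMod (P : C) where
  gm : GradedModule P
  d : ∀ {n m : ℤ}, m + 1 = n → (gm.M n →+ gm.M m)
  d_sq : ∀ {n m j : ℤ} (h : m + 1 = n) (h' : j + 1 = m) (x : gm.M n), d h' (d h x) = 0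
  d_smul : ∀ {n m j l l' : ℤ} (h : m + 1 = n) (hl : n + j = l) (hl' : l' + 1 = l)
    (hm : m + j = l') (x : gm.M n) (a : lam P j),
    d hl' (gm.smul hl x a) = gm.smul hm (d h x) a

/-- A morphism of DG `Λ`-modules: a morphism of the underlying graded modules commuting
with the differentials. -/
structure DGHom {P : C} (M N : DGMod P) where
  g : GHom M.gm N.gm
  comm : ∀ {n m : ℤ} (h : m + 1 = n) (x : M.gm.M n),
    g.app m (M.d h x) = N.d h (g.app n x)

@[ext] theorem DGHom.ext {P : C} {M N : DGMod P} {f f' : DGHom M N}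
    (h : ∀ (n : ℤ) (x : M.gm.M n), f.g.app n x = f'.g.app n x) : f = f' := by
  obtain ⟨fg, _⟩ := f; obtain ⟨fg', _⟩ := f'
  congr 1
  exact GHom.ext h

/-- The category of differential graded right `Λ`-modules. -/
instance dgModCategory (P : C) : Category (DGMod P) where
  Hom M N := DGHom M N
  id M := ⟨GHom.id _, fun _ _ => rfl⟩
  comp f g := ⟨g.g.comp f.g, fun h x => by
    show g.g.app _ (f.g.app _ _) = _
    rw [f.comm, g.comm]
    rfl⟩
  id_comp f := by apply DGHom.ext; intros; rfl
  comp_id f := by apply DGHom.ext; intros; rfl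
  assoc f g h := by apply DGHom.ext; intros; rfl

/-- The cycles `ker dₙ` of a DG module in degree `n`. -/
abbrev cycles {P : C} (M : DGMod P) (n : ℤ) : AddSubgroup (M.gm.M n) :=
  AddMonoidHom.ker (M.d (n := n) (m := n - 1) (by omega))

/-- The boundaries `im d_{n+1}` of a DG module in degree `n`. -/
abbrev boundaries {P : C} (M : DGMod P) (n : ℤ) : AddSubgroup (M.gm.M n) :=
  AddMonoidHom.range (M.d (n := n + 1) (m := n) rfl)

/-- The homology `H_n M = ker dₙ / im d_{n+1}` of a DG module. -/
abbrev dgHomology {P : C} (M : DGMod P) (n : ℤ) : Type v :=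
  cycles M n ⧸ (boundaries M n).addSubgroupOf (cycles M n)

/-- The map induced on cycles by a morphism of DG modules. -/
def cyclesMap {P : C} {M N : DGMod P} (f : M ⟶ N) (n : ℤ) : cycles M n →+ cycles N n :=
  AddMonoidHom.codRestrict ((f.g.app n).comp (cycles M n).subtype) _ (fun x => by
    have hx : M.d (show (n - 1) + 1 = n by omega) x.1 = 0 := x.2
    have : N.d (show (n - 1) + 1 = n by omega) (f.g.app n x.1) = 0 := by
      rw [← f.comm (show (n - 1) + 1 = n by omega), hx, map_zero]
    exact this)

/-- The map induced on homology by a morphism of DG modules. -/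
def dgHomologyMap {P : C} {M N : DGMod P} (f : M ⟶ N) (n : ℤ) :
    dgHomology M n →+ dgHomology N n :=
  QuotientAddGroup.map _ _ (cyclesMap f n) (by
    intro x hx
    have hx' : x.1 ∈ boundaries M n := hx
    obtain ⟨y, hy⟩ := AddMonoidHom.mem_range.mp hx'
    have : (f.g.app n x.1) ∈ boundaries N n := by
      refine AddMonoidHom.mem_range.mpr ⟨f.g.app (n + 1) y, ?_⟩
      rw [← f.comm rfl y, hy]
    exact this)

/-- A quasi-isomorphism of DG modules: a morphism inducing an isomorphism on homology. -/
def quasiIso (P : C) : MorphismProperty (DGMod P) :=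
  fun _ _ f => ∀ n : ℤ, Function.Bijective (dgHomologyMap f n)

/-- The derived category `D(Λ)` of the graded endomorphism ring `Λ = End_T(P)_*`
(regarded as a DG ring with zero differential): the localization of the category of
DG right `Λ`-modules at the quasi-isomorphisms. -/
abbrev DerivedCat (P : C) := (quasiIso P).Localization

end DG


section Realization

open Classical in
theorem compactComparison_of {ι : Type v} [HasCoproducts.{v} C] (P : C) (X : ι → C) (i : ι)
    (f : P ⟶ X i) :
    compactComparison P X (DirectSum.of (fun i => (P ⟶ X i)) i f) = f ≫ Sigma.ι X i := by
  exact DirectSum.toAddMonoid_of _ _ _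

/-- Shifts of compact objects are compact. -/
theorem IsCompactObj.shift [HasCoproducts.{v} C] {P : C} (hP : IsCompactObj P) (m : ℤ) :
    IsCompactObj (P⟦m⟧) := by
  classical
  intro ι X
  let adj : shiftFunctor C m ⊣ shiftFunctor C (-m) := (shiftEquiv C m).toAdjunction
  let σ := sigmaComparison (shiftFunctor C (-m)) X
  let Φ : (P⟦m⟧ ⟶ ∐ X) ≃+ (P ⟶ ∐ fun i => (X i)⟦-m⟧) :=
    (adj.homAddEquiv P (∐ X)).trans
      { (asIso σ).symm.homToEquiv with
        map_add' := fun f g => Preadditive.add_comp _ _ _ f g _ }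
  let Ψ : (⨁ i, (P⟦m⟧ ⟶ X i)) ≃+ ⨁ i, (P ⟶ (X i)⟦-m⟧) :=
    DFinsupp.mapRange.addEquiv fun i => adj.homAddEquiv P (X i)
  have h : Φ.toAddMonoidHom.comp (compactComparison (P⟦m⟧) X) =
      (compactComparison P fun i => (X i)⟦-m⟧).comp Ψ.toAddMonoidHom := by
    ext i f
    have hΨ : Ψ (DirectSum.of (fun i => (P⟦m⟧ ⟶ X i)) i f) =
        DirectSum.of (fun i => (P ⟶ (X i)⟦-m⟧)) i (adj.homAddEquiv P (X i) f) :=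
      DFinsupp.mapRange_single (hf := fun i => (adj.homAddEquiv P (X i)).map_zero)
    simp only [AddMonoidHom.comp_apply, AddEquiv.coe_toAddMonoidHom]
    rw [hΨ, compactComparison_of, compactComparison_of]
    change adj.homEquiv P _ (f ≫ Sigma.ι X i) ≫ inv σ = adj.homEquiv P _ f ≫ _
    rw [adj.homEquiv_naturality_right, Category.assoc, map_ι_comp_inv_sigmaComparison]
  have hb : Function.Bijective (Φ ∘ compactComparison (P⟦m⟧) X) := by
    have hc := (hP ι fun i => (X i)⟦-m⟧).comp Ψ.bijective
    convert hc using 1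
    exact congrArg DFunLike.coe h
  exact (Function.Bijective.of_comp_iff' Φ.bijective _).1 hb

/-- Every morphism `Σˡ P ⟶ Σⁿ P` is given by the action of a unique element of `Λ`. -/
theorem gsmulHom_id_bijective (P : C) {n k l : ℤ} (h : n + k = l) :
    Function.Bijective (fun a : lam P k => gsmulHom P h (𝟙 (P⟦n⟧)) a) := by
  constructor
  · intro a b hab
    simp only [gsmulHom, Category.comp_id] at hab
    exact (shiftFunctor C n).map_injective ((cancel_epi _).1 hab)
  · intro f
    obtain ⟨a, ha⟩ := (shiftFunctor C n).map_surjective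
      ((shiftFunctorAdd' C k n l (by omega)).inv.app P ≫ f)
    exact ⟨a, by simp [gsmulHom, ha]⟩

/-- The additive equivalence `Λₖ ≃ Hom(Σˡ P, Σⁿ P)` for `n + k = l`. -/
noncomputable def lamEquiv (P : C) {n k l : ℤ} (h : n + k = l) :
    lam P k ≃+ (P⟦l⟧ ⟶ P⟦n⟧) :=
  AddEquiv.ofBijective
    (AddMonoidHom.mk' (fun a : lam P k => gsmulHom P h (𝟙 (P⟦n⟧)) a)
      fun a b => (piMod P (P⟦n⟧)).smul_addₓ h _ a b)
    (gsmulHom_id_bijective P h)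

theorem lamEquiv_comp (P : C) {X : C} {n k l : ℤ} (h : n + k = l) (a : lam P k)
    (m : P⟦n⟧ ⟶ X) : lamEquiv P h a ≫ m = gsmulHom P h m a := by
  change gsmulHom P h (𝟙 _) a ≫ m = _
  simp [gsmulHom]

/-- The action on a fixed element `m : Mₙ` as an additive map `Λₖ →+ M_{n+k}`. -/
def GradedModule.actAddHom {P : C} (M : GradedModule P) {n k l : ℤ} (h : n + k = l)
    (m : M.M n) : lam P k →+ M.M l :=
  AddMonoidHom.mk' (fun a => M.smul h m a) (fun a b => M.smul_addₓ h m a b)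

section Free

variable [HasCoproducts.{v} C] {P : C} {I : Type v} (deg : I → ℤ)

/-- The coproduct `∐ᵢ Σ^{deg i} P`, whose graded homotopy is a free graded module. -/
noncomputable abbrev freeObj (P : C) {I : Type v} (deg : I → ℤ) : C :=
  ∐ fun i => P⟦deg i⟧

/-- The basis element of `π_* (∐ᵢ Σ^{deg i} P)` indexed by `i`. -/
noncomputable abbrev freeι (P : C) {I : Type v} (deg : I → ℤ) (i : I) :
    P⟦deg i⟧ ⟶ freeObj P deg :=
  Sigma.ι (fun i => P⟦deg i⟧) i

/-- Elements of `π_* (∐ᵢ Σ^{deg i} P)` are sums of multiples of the basis elements. -/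
theorem freeObj_induction (hP : IsCompactObj P) {l : ℤ} {p : (P⟦l⟧ ⟶ freeObj P deg) → Prop}
    (zero : p 0) (add : ∀ f g, p f → p g → p (f + g))
    (gen : ∀ (i : I) (k : ℤ) (h : deg i + k = l) (a : lam P k),
      p (gsmulHom P h (freeι P deg i) a)) (f : P⟦l⟧ ⟶ freeObj P deg) : p f := by
  classical
  obtain ⟨d, rfl⟩ := (hP.shift l I fun i => P⟦deg i⟧).2 f
  induction d using DirectSum.induction_on with
  | zero => simpa using zero
  | of i x =>
    have h : deg i + (l - deg i) = l := by omega
    obtain ⟨a, rfl⟩ := (lamEquiv P h).surjective x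
    rw [compactComparison_of, lamEquiv_comp]
    exact gen i _ h a
  | add x y hx hy =>
    rw [map_add]
    exact add _ _ hx hy

theorem GHom.free_ext (hP : IsCompactObj P) {N : GradedModule P}
    {f g : GHom (piMod P (freeObj P deg)) N}
    (h : ∀ i, f.app _ (freeι P deg i) = g.app _ (freeι P deg i)) : f = g := by
  ext l x
  induction x using freeObj_induction deg hP with
  | zero => rw [map_zero, map_zero]
  | add x y hx hy => rw [map_add, map_add, hx, hy]
  | gen i k hk a =>
    exact (f.app_smul hk (freeι P deg i) a).trans
      ((congrArg (fun y => N.smul hk y a) (h i)).trans (g.app_smul hk (freeι P deg i) a).symm)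

/-- The additive map in degree `l` underlying `freeLift`. -/
noncomputable def freeLiftApp (hP : IsCompactObj P) {N : GradedModule P}
    (y : ∀ i, N.M (deg i)) (l : ℤ) : (P⟦l⟧ ⟶ freeObj P deg) →+ N.M l := by
  classical
  exact (DirectSum.toAddMonoid fun i =>
      (N.actAddHom (by omega : deg i + (l - deg i) = l) (y i)).comp
        (lamEquiv P (by omega : deg i + (l - deg i) = l)).symm.toAddMonoidHom).comp
    (AddEquiv.ofBijective _ (hP.shift l I fun i => P⟦deg i⟧)).symm.toAddMonoidHom

theorem freeLiftApp_gsmulHom (hP : IsCompactObj P) {N : GradedModule P}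
    (y : ∀ i, N.M (deg i)) {k l : ℤ} (i : I) (h : deg i + k = l) (a : lam P k) :
    freeLiftApp deg hP y l (gsmulHom P h (freeι P deg i) a) = N.smul h (y i) a := by
  classical
  obtain rfl : k = l - deg i := by omega
  have key : (AddEquiv.ofBijective _ (hP.shift l I fun i => P⟦deg i⟧)).symm
      (gsmulHom P h (freeι P deg i) a) =
      DirectSum.of (fun i => (P⟦l⟧ ⟶ P⟦deg i⟧)) i (lamEquiv P h a) := by
    rw [AddEquiv.symm_apply_eq, AddEquiv.ofBijective_apply, compactComparison_of,
      lamEquiv_comp]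
  simp only [freeLiftApp, AddMonoidHom.comp_apply, AddEquiv.coe_toAddMonoidHom]
  erw [key, DirectSum.toAddMonoid_of]
  simp [GradedModule.actAddHom]

/-- The morphism from `π_* (∐ᵢ Σ^{deg i} P)` with prescribed values on the basis. -/
noncomputable def freeLift (hP : IsCompactObj P) {N : GradedModule P}
    (y : ∀ i, N.M (deg i)) : GHom (piMod P (freeObj P deg)) N where
  app := freeLiftApp deg hP y
  app_smul {n k l} h m a := by
    induction m using freeObj_induction deg hP with
    | zero => rw [GradedModule.zero_smulₓ, map_zero, map_zero, GradedModule.zero_smulₓ]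
    | add x y hx hy =>
      rw [GradedModule.add_smulₓ, map_add, map_add, hx, hy, GradedModule.add_smulₓ]
    | gen i j hj b =>
      have h' : deg i + (j + k) = l := by omega
      have e := (piMod P (freeObj P deg)).smul_mulₓ hj rfl h h' (freeι P deg i) b a
      rw [freeLiftApp_gsmulHom, N.smul_mulₓ hj rfl h h', ← freeLiftApp_gsmulHom deg hP y i h']
      exact congrArg _ e

theorem freeLift_freeι (hP : IsCompactObj P) {N : GradedModule P}
    (y : ∀ i, N.M (deg i)) (i : I) :
    (freeLift deg hP y).app _ (freeι P deg i) = y i := by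
  have h := freeLiftApp_gsmulHom deg hP y i (add_zero _) (gone P)
  rw [N.smul_oneₓ] at h
  rw [← h]
  exact congrArg _ ((piMod P (freeObj P deg)).smul_oneₓ _).symm

/-- Every graded module morphism out of `π_* (∐ᵢ Σ^{deg i} P)` into some `π_* X` is
realized by a morphism in `C`. -/
theorem exists_piGHom_eq (hP : IsCompactObj P) {X : C}
    (g : GHom (piMod P (freeObj P deg)) (piMod P X)) :
    ∃ φ : freeObj P deg ⟶ X, piGHom P φ = g :=
  ⟨Sigma.desc fun i => g.app _ (freeι P deg i),
    GHom.free_ext deg hP fun i => Sigma.ι_desc _ i⟩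

end Free

theorem piGHom_comp (P : C) {X Y Z : C} (f : X ⟶ Y) (g : Y ⟶ Z) :
    piGHom P (f ≫ g) = (piGHom P g).comp (piGHom P f) := by
  ext n x
  exact (Category.assoc (x : P⟦n⟧ ⟶ X) f g).symm

theorem piGHom_id (P X : C) : piGHom P (𝟙 X) = GHom.id (piMod P X) := by
  ext n x
  exact Category.comp_id (x : P⟦n⟧ ⟶ X)

/-- A complement of a split monomorphism in a pretriangulated category. -/
theorem exists_split_complement {Y : C} {f r : Y ⟶ Y} (hfr : f ≫ r = 𝟙 Y) :
    ∃ (G : C) (g : Y ⟶ G) (s : G ⟶ Y), s ≫ g = 𝟙 G ∧ g ≫ s = 𝟙 Y - r ≫ f := by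
  obtain ⟨G, g, h, hT⟩ := distinguished_cocone_triangle f
  have hfg : f ≫ g = 0 := comp_distTriang_mor_zero₁₂ _ hT
  have hh : h = 0 := by
    have h₁ : h ≫ f⟦(1 : ℤ)⟧' = 0 := comp_distTriang_mor_zero₃₁ _ hT
    have h₂ : f⟦(1 : ℤ)⟧' ≫ r⟦(1 : ℤ)⟧' = 𝟙 _ := by
      rw [← Functor.map_comp, hfr, CategoryTheory.Functor.map_id]
    rw [← Category.comp_id h, ← h₂, reassoc_of% h₁, zero_comp]
  obtain ⟨s, hs⟩ := Triangle.coyoneda_exact₃ _ hT (𝟙 G) (by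
    change 𝟙 G ≫ h = 0
    rw [hh, comp_zero])
  change G ⟶ Y at s
  change 𝟙 G = s ≫ g at hs
  have hsg : (s - s ≫ r ≫ f) ≫ g = 𝟙 G := by simp [hfg, ← hs]
  refine ⟨G, g, s - s ≫ r ≫ f, hsg, ?_⟩
  obtain ⟨u, hu⟩ := Triangle.coyoneda_exact₂ _ hT
    (g ≫ (s - s ≫ r ≫ f) - (𝟙 Y - r ≫ f)) (by
      change (g ≫ (s - s ≫ r ≫ f) - (𝟙 Y - r ≫ f)) ≫ g = 0
      rw [Preadditive.sub_comp, Category.assoc, hsg]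
      simp [hfg])
  change Y ⟶ Y at u
  change g ≫ (s - s ≫ r ≫ f) - (𝟙 Y - r ≫ f) = u ≫ f at hu
  have hu0 : u = 0 := by
    have hur : (u ≫ f) ≫ r = 0 := by
      rw [← hu]
      simp [hfr]
    rwa [Category.assoc, hfr, Category.comp_id] at hur
  rwa [hu0, zero_comp, sub_eq_zero] at hu

/-- Idempotents split in a pretriangulated category with countable coproducts. -/
theorem exists_idempotent_splitting [HasCoproductsOfShape (ULift.{v} ℕ) C] {X : C} (φ : X ⟶ X)
    (hφ : φ ≫ φ = φ) : ∃ (G : C) (p : X ⟶ G) (i : G ⟶ X), i ≫ p = 𝟙 G ∧ p ≫ i = φ := by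
  let Y : C := ∐ fun _ : ULift.{v} ℕ => X
  let j (n : ℕ) : X ⟶ Y := Sigma.ι (fun _ : ULift.{v} ℕ => X) ⟨n⟩
  have hY {Z : C} {a b : Y ⟶ Z} (h : ∀ n, j n ≫ a = j n ≫ b) : a = b :=
    Sigma.hom_ext _ _ fun n => h n.down
  let desc {Z : C} (a : ℕ → (X ⟶ Z)) : Y ⟶ Z := Sigma.desc fun n => a n.down
  have hdesc {Z : C} (a : ℕ → (X ⟶ Z)) (n : ℕ) : j n ≫ desc a = a n := Sigma.ι_desc _ _
  let prev : ℕ → (X ⟶ Y) := fun n => n.casesOn 0 fun m => φ ≫ j m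
  let f : Y ⟶ Y := desc fun n => φ ≫ j (n + 1) + (𝟙 X - φ) ≫ j n
  let r : Y ⟶ Y := desc fun n => prev n + (𝟙 X - φ) ≫ j n
  let π : Y ⟶ X := desc fun n => n.casesOn (𝟙 X) fun _ => 0
  have hf (n : ℕ) : j n ≫ f = φ ≫ j (n + 1) + (𝟙 X - φ) ≫ j n :=
    hdesc (fun n => φ ≫ j (n + 1) + (𝟙 X - φ) ≫ j n) n
  have hr (n : ℕ) : j n ≫ r = prev n + (𝟙 X - φ) ≫ j n :=
    hdesc (fun n => prev n + (𝟙 X - φ) ≫ j n) n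
  have hφprev (n : ℕ) : φ ≫ prev n = prev n := by
    cases n with
    | zero => exact comp_zero
    | succ m => change φ ≫ φ ≫ j m = φ ≫ j m; rw [reassoc_of% hφ]
  have hπ : j 0 ≫ π = 𝟙 X := hdesc _ 0
  have hfr : f ≫ r = 𝟙 Y := by
    refine hY fun n => ?_
    rw [reassoc_of% hf n]
    simp only [Preadditive.add_comp, Preadditive.sub_comp, Category.assoc, hr,
      Preadditive.comp_add, Preadditive.comp_sub, Category.id_comp, Category.comp_id, hφprev,
      reassoc_of% hφ]
    rw [show prev (n + 1) = φ ≫ j n from rfl]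
    abel
  have hrf : 𝟙 Y - r ≫ f = π ≫ φ ≫ j 0 := by
    refine hY fun n => ?_
    rw [Preadditive.comp_sub, reassoc_of% hr n]
    cases n with
    | zero =>
      rw [reassoc_of% hπ]
      change _ - (0 + _) ≫ f = _
      simp only [zero_add, Preadditive.sub_comp, Category.assoc, hf,
        Preadditive.comp_add, Preadditive.comp_sub, Category.id_comp, Category.comp_id,
        reassoc_of% hφ]
      abel
    | succ m =>
      have hπ' : j (m + 1) ≫ π = 0 := hdesc _ (m + 1)
      rw [reassoc_of% hπ', zero_comp]
      change _ - (φ ≫ j m + _) ≫ f = _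
      simp only [Preadditive.add_comp, Preadditive.sub_comp, Category.assoc, hf,
        Preadditive.comp_add, Preadditive.comp_sub, Category.id_comp, Category.comp_id,
        reassoc_of% hφ]
      abel
  obtain ⟨G, g, s, hsg, hgs⟩ := exists_split_complement hfr
  rw [hrf] at hgs
  have hs : s = s ≫ π ≫ φ ≫ j 0 := by rw [← hgs, reassoc_of% hsg]
  refine ⟨G, j 0 ≫ g, s ≫ π, ?_, ?_⟩
  · have : s ≫ π ≫ j 0 ≫ g = s ≫ g := by
      conv_lhs => rw [hs]
      conv_rhs => rw [hs]
      simp only [Category.assoc, reassoc_of% hπ]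
    rw [Category.assoc, this, hsg]
  · rw [Category.assoc, reassoc_of% hgs, hπ, Category.comp_id, reassoc_of% hπ]

end Realization

/-- If `P` is a compact generator of the triangulated category `C`,
then every projective graded right `Λ`-module `M` is realized as `π_* G` for some
object `G` of `C`. -/
theorem statement_1 [IsTriangulated C] [HasCoproducts.{v} C]
    (P : C) (hcpt : IsCompactObj P) (hgen : IsGenerator P)
    (M : GradedModule P) (hM : IsProjective M) :
    ∃ G : C, Nonempty (GIso (piMod P G) M) := by
  let deg : (Σ n, M.M n) → ℤ := Sigma.fst
  let e : GHom (piMod P (freeObj P deg)) M := freeLift deg hcpt Sigma.snd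
  have he : e.Surj := fun n x => ⟨freeι P deg ⟨n, x⟩, freeLift_freeι deg hcpt Sigma.snd ⟨n, x⟩⟩
  obtain ⟨s, hs⟩ := hM _ _ e he (GHom.id M)
  obtain ⟨φ, hφ⟩ := exists_piGHom_eq deg hcpt (s.comp e)
  have hes (n : ℤ) (x : M.M n) : e.app n (s.app n x) = x :=
    DFunLike.congr_fun (congrFun (congrArg GHom.app hs) n) x
  have hφφ : φ ≫ φ = φ := by
    refine Sigma.hom_ext _ _ fun i => ?_
    have key : piGHom P (φ ≫ φ) = piGHom P φ := by
      rw [piGHom_comp, hφ]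
      ext n x
      exact congrArg (s.app n) (hes n _)
    exact DFunLike.congr_fun (congrFun (congrArg GHom.app key) _) (freeι P deg i)
  obtain ⟨G, p, i, hip, hpi⟩ := exists_idempotent_splitting φ hφφ
  refine ⟨G, ⟨⟨e.comp (piGHom P i), (piGHom P p).comp s, ?_, ?_⟩⟩⟩
  · calc
      _ = (piGHom P p).comp ((s.comp e).comp (piGHom P i)) := rfl
      _ = piGHom P ((i ≫ φ) ≫ p) := by rw [← hφ, piGHom_comp, piGHom_comp]
      _ = GHom.id _ := by
        rw [← hpi, Category.assoc, Category.assoc, hip, Category.comp_id, hip, piGHom_id]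
  · calc
      _ = e.comp ((((piGHom P i).comp (piGHom P p))).comp s) := rfl
      _ = e.comp ((s.comp e).comp s) := by rw [← piGHom_comp, hpi, hφ]
      _ = GHom.id M := by
        ext n x
        exact (hes n _).trans (hes n x)

end Franke
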